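/- Let k ≥ 2 be an integer and D a positive non-square discriminant. For every x ∈ ℝ the family (Q(x)^{k−1})_{Q ∈ 𝒬_D⟨x⟩} is summable, and the index set 𝒬_D⟨x⟩ is finite if and only if x is rational. Moreover, for irrational x the convergence is exponential: there exist C > 0 and θ ∈ (0,1) such that δ_i ≤ Cθ^i for all i ≥ 0, and for every Q(X) = aX² + bX + c in 𝒬_D one has (Q|γ_i)(x) = a δ_{i−1}² + b δ_{i−1}δ_i + c δ_i². -/

import Mathlib

open Polynomial Matrix

noncomputable section

abbrev Mat2 := Matrix (Fin 2) (Fin 2) ℤ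

/-- The matrix `Tⁿ = [[1,n],[0,1]]`. -/
def Tpow (n : ℤ) : Mat2 := !![1, n; 0, 1]

/-- The matrix `ε = [[0,1],[1,0]]`. -/
def Meps : Mat2 := !![0, 1; 1, 0]

/-- The matrix `S = [[0,-1],[1,0]]`. -/
def MS : Mat2 := !![0, -1; 1, 0]

/-- The matrix `T = [[1,1],[0,1]]`. -/
def MT : Mat2 := !![1, 1; 0, 1]

/-- The matrix `σ = [[-1,0],[0,1]]`. -/
def Msig : Mat2 := !![-1, 0; 0, 1]

/-- The matrix `U = TS = [[1,-1],[1,0]]`. -/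
def MU : Mat2 := MT * MS

/-- Möbius action of an integer matrix on a real number. -/
def moeb (M : Mat2) (x : ℝ) : ℝ :=
  ((M 0 0 : ℝ) * x + (M 0 1 : ℝ)) / ((M 1 0 : ℝ) * x + (M 1 1 : ℝ))

/-- The sequence `x_i` of the (positive) continued fraction algorithm:
`x_0 = x`, `x_{i+1} = 1/(x_i - ⌊x_i⌋)`. -/
def cfX (x : ℝ) : ℕ → ℝ
  | 0 => x
  | i + 1 => 1 / (cfX x i - (⌊cfX x i⌋ : ℝ))

/-- The partial quotients `n_i = ⌊x_i⌋` of the continued fraction of `x`. -/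
def cfN (x : ℝ) (i : ℕ) : ℤ := ⌊cfX x i⌋

/-- The matrices `γ_0 = Id`, `γ_{i+1} = ε T^{-n_i} γ_i`. -/
def gam (x : ℝ) : ℕ → Mat2
  | 0 => 1
  | i + 1 => (Meps * Tpow (-(cfN x i))) * gam x i

/-- `Γ(x) = {γ_1, γ_2, γ_3, …}`. -/
def GammaSet (x : ℝ) : Set Mat2 := {M | ∃ i, 1 ≤ i ∧ M = gam x i}

/-- The matrices `γ'_0 = Id`, `γ'_{i+1} = Tγ'_i` if `γ'_i(x) ≤ 0`,
`T^{-1}εγ'_i` if `0 < γ'_i(x) ≤ 1`, and `T^{-1}γ'_i` if `γ'_i(x) > 1`. -/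
def gam' (x : ℝ) : ℕ → Mat2
  | 0 => 1
  | i + 1 =>
    if moeb (gam' x i) x ≤ 0 then MT * gam' x i
    else if moeb (gam' x i) x ≤ 1 then (Tpow (-1) * Meps) * gam' x i
    else Tpow (-1) * gam' x i

/-- `Γ(x)' = {γ'_1, γ'_2, γ'_3, …}`. -/
def GammaSet' (x : ℝ) : Set Mat2 := {M | ∃ i, 1 ≤ i ∧ M = gam' x i}

/-- The sequence `x_i` of the negative continued fraction algorithm:
`x_0 = x`, `x_{i+1} = 1/(⌈x_i⌉ - x_i)`. -/
def ncfX (x : ℝ) : ℕ → ℝ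
  | 0 => x
  | i + 1 => 1 / ((⌈ncfX x i⌉ : ℝ) - ncfX x i)

/-- The partial quotients `m_i = ⌈x_i⌉` of the negative continued fraction of `x`. -/
def ncfM (x : ℝ) (i : ℕ) : ℤ := ⌈ncfX x i⌉

/-- The matrices `γ̃_0 = Id`, `γ̃_{i+1} = S T^{-m_i} γ̃_i`. -/
def gamt (x : ℝ) : ℕ → Mat2
  | 0 => 1
  | i + 1 => (MS * Tpow (-(ncfM x i))) * gamt x i

/-- `Γ₁(x) = {γ̃_1, γ̃_2, γ̃_3, …}`. -/
def Gamma1Set (x : ℝ) : Set Mat2 := {M | ∃ i, 1 ≤ i ∧ M = gamt x i}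

/-- A binary quadratic polynomial `aX² + bX + c`, encoded as the triple `(a,b,c)`. -/
abbrev QF := ℤ × ℤ × ℤ

/-- The value of `aX² + bX + c` at a real number `x`. -/
def Qval (q : QF) (x : ℝ) : ℝ := (q.1 : ℝ) * x ^ 2 + (q.2.1 : ℝ) * x + (q.2.2 : ℝ)

/-- The value of `aX² + bX + c` at an integer `m`. -/
def QvalZ (q : QF) (m : ℤ) : ℤ := q.1 * m ^ 2 + q.2.1 * m + q.2.2

/-- The discriminant `b² - 4ac`. -/
def Qdisc (q : QF) : ℤ := q.2.1 ^ 2 - 4 * q.1 * q.2.2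

/-- The homogenized value `a r² + b r t + c t²`; for `t ≠ 0` its sign is that of `Q(r/t)`,
and for `t = 0` that of the leading coefficient, i.e. of `Q(∞)`. -/
def Qhom (q : QF) (r t : ℤ) : ℤ := q.1 * r ^ 2 + q.2.1 * r * t + q.2.2 * t ^ 2

/-- The weight 2 action `(Q|γ)(X) = (tX+u)² Q((rX+s)/(tX+u))` on quadratic polynomials,
for `γ = [[r,s],[t,u]]`. -/
def qslash (M : Mat2) (q : QF) : QF :=
  (Qhom q (M 0 0) (M 1 0),
   2 * q.1 * M 0 0 * M 0 1 + q.2.1 * (M 0 0 * M 1 1 + M 0 1 * M 1 0) + 2 * q.2.2 * M 1 0 * M 1 1,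
   Qhom q (M 0 1) (M 1 1))

/-- The set `𝒬` of integral quadratic polynomials with positive non-square discriminant. -/
def Qset : Set QF := {q | 0 < Qdisc q ∧ ¬ IsSquare (Qdisc q)}

/-- `A` is a `Γ`-equivalence class in `𝒬`, where `Γ = PGL₂(ℤ)`. -/
def IsClassQ (A : Set QF) : Prop :=
  ∃ q₀ ∈ Qset, A = {q ∈ Qset | ∃ M : Mat2, IsUnit M.det ∧ q = qslash M q₀}

/-- `B` is a `Γ₁`-equivalence class in `𝒬`, where `Γ₁ = PSL₂(ℤ)`. -/
def IsClassQ1 (B : Set QF) : Prop :=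
  ∃ q₀ ∈ Qset, B = {q ∈ Qset | ∃ M : Mat2, M.det = 1 ∧ q = qslash M q₀}

/-- `A^Sim = {Q ∈ A : Q(0) < 0 < Q(∞)}`. -/
def QSim (A : Set QF) : Set QF := {q ∈ A | q.2.2 < 0 ∧ 0 < q.1}

/-- `A^Red = {Q ∈ A : Q(∞) > 0, Q(-1) < 0 < Q(0)}`. -/
def QRed (A : Set QF) : Set QF := {q ∈ A | 0 < q.1 ∧ q.1 - q.2.1 + q.2.2 < 0 ∧ 0 < q.2.2}

/-- `A⟨x⟩ = {Q ∈ A : Q(∞) < 0 < Q(x)}`. -/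
def QxSet (A : Set QF) (x : ℝ) : Set QF := {q ∈ A | q.1 < 0 ∧ 0 < Qval q x}

/-- `𝒬_D⟨x⟩`, the set of quadratics of discriminant `D` with `Q(∞) < 0 < Q(x)`. -/
def QDx (D : ℕ) (x : ℝ) : Set QF :=
  {q | Qdisc q = (D : ℤ) ∧ q.1 < 0 ∧ 0 < Qval q x}

/-- The simple forms of discriminant `D`: `a > 0 > c`. -/
def SimpleD (D : ℕ) : Set QF := {q | Qdisc q = (D : ℤ) ∧ 0 < q.1 ∧ q.2.2 < 0}

/-- The reduced forms of discriminant `D`: `a > 0`, `c > 0`, `b > a + c`. -/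
def ReducedD (D : ℕ) : Set QF :=
  {q | Qdisc q = (D : ℤ) ∧ 0 < q.1 ∧ 0 < q.2.2 ∧ q.1 + q.2.2 < q.2.1}

/-- Homogenized evaluation of a polynomial of degree ≤ d: `∑ P_j r^j t^{d-j}`;
for `t ≠ 0` its sign is that of `P(r/t)` (`d` even), and for `t = 0` that of `P(∞)`. -/
def homEval (d : ℕ) (P : Polynomial ℤ) (r t : ℤ) : ℤ :=
  ∑ j ∈ Finset.range (d + 1), P.coeff j * r ^ j * t ^ (d - j)

/-- The weight `d` action `(P|γ)(X) = (tX+u)^d P((rX+s)/(tX+u))` on integral polynomials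
of degree at most `d`, for `γ = [[r,s],[t,u]]`. -/
def pslash (d : ℕ) (M : Mat2) (P : Polynomial ℤ) : Polynomial ℤ :=
  ∑ j ∈ Finset.range (d + 1),
    C (P.coeff j) * (C (M 0 0) * X + C (M 0 1)) ^ j * (C (M 1 0) * X + C (M 1 1)) ^ (d - j)

/-- `P` has exactly two real roots `w ≠ w'`, both irrational. -/
def HasTwoIrratRoots (P : Polynomial ℤ) (w w' : ℝ) : Prop :=
  w ≠ w' ∧ Irrational w ∧ Irrational w' ∧ ∀ y : ℝ, Polynomial.aeval y P = 0 ↔ y = w ∨ y = w'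

/-- `F_d`: integral polynomials of degree ≤ d with exactly two real roots, both irrational. -/
def Fd (d : ℕ) : Set (Polynomial ℤ) :=
  {P | P.natDegree ≤ d ∧ ∃ w w' : ℝ, HasTwoIrratRoots P w w'}

/-- `A` is a `Γ`-equivalence class in `F_d`, where `Γ = PGL₂(ℤ)`. -/
def IsClassF (d : ℕ) (A : Set (Polynomial ℤ)) : Prop :=
  ∃ P₀ ∈ Fd d, A = {P ∈ Fd d | ∃ M : Mat2, IsUnit M.det ∧ P = pslash d M P₀}

/-- `B` is a `Γ₁`-equivalence class in `F_d`, where `Γ₁ = PSL₂(ℤ)`. -/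
def IsClassF1 (d : ℕ) (B : Set (Polynomial ℤ)) : Prop :=
  ∃ P₀ ∈ Fd d, B = {P ∈ Fd d | ∃ M : Mat2, M.det = 1 ∧ P = pslash d M P₀}

/-- `A^Sim = {P ∈ A : P(0) < 0 < P(∞)}`, where `P(∞)` is the coefficient of `X^d`. -/
def PSim (d : ℕ) (A : Set (Polynomial ℤ)) : Set (Polynomial ℤ) :=
  {P ∈ A | P.coeff 0 < 0 ∧ 0 < P.coeff d}

/-- `A^Red = {P ∈ A : P(∞) > 0 and P(-1) < 0 < P(0)}`. -/
def PRed (d : ℕ) (A : Set (Polynomial ℤ)) : Set (Polynomial ℤ) :=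
  {P ∈ A | 0 < P.coeff d ∧ Polynomial.aeval (-1 : ℤ) P < 0 ∧ 0 < P.coeff 0}

/-- `A⟨x⟩ = {P ∈ A : P(∞) < 0 < P(x)}`. -/
def Px (d : ℕ) (A : Set (Polynomial ℤ)) (x : ℝ) : Set (Polynomial ℤ) :=
  {P ∈ A | P.coeff d < 0 ∧ 0 < Polynomial.aeval x P}

/-- The numerators of the convergents, shifted by 2: `pconv x i = p_{i-2}`. -/
def pconv (x : ℝ) : ℕ → ℤ
  | 0 => 0
  | 1 => 1
  | i + 2 => cfN x i * pconv x (i + 1) + pconv x i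

/-- The denominators of the convergents, shifted by 2: `qconv x i = q_{i-2}`. -/
def qconv (x : ℝ) : ℕ → ℤ
  | 0 => 1
  | 1 => 0
  | i + 2 => cfN x i * qconv x (i + 1) + qconv x i

/-- `δ_i = (-1)^i (p_{i-1} - q_{i-1} x)` for `i ≥ 0`. -/
def cfDelta (x : ℝ) (i : ℕ) : ℝ :=
  (-1 : ℝ) ^ i * ((pconv x (i + 1) : ℝ) - (qconv x (i + 1) : ℝ) * x)

/-- The weight `d` action `(P|γ)(X) = (tX+u)^d P((rX+s)/(tX+u))` on complex polynomials
of degree at most `d`, for `γ = [[r,s],[t,u]]` with integer entries. -/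
def cslash (d : ℕ) (M : Mat2) (P : Polynomial ℂ) : Polynomial ℂ :=
  ∑ j ∈ Finset.range (d + 1),
    C (P.coeff j) * (C (M 0 0 : ℂ) * X + C (M 0 1 : ℂ)) ^ j *
      (C (M 1 0 : ℂ) * X + C (M 1 1 : ℂ)) ^ (d - j)

/-- `P^Γ(x) = ∑_{γ ∈ Γ(x)} (P|γ)(x)` for `P` of degree ≤ 2k. -/
def PGam (k : ℕ) (P : Polynomial ℂ) (x : ℝ) : ℂ :=
  ∑' γ : GammaSet x, Polynomial.eval (x : ℂ) (cslash (2 * k) γ.1 P)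

theorem Qval_qslash (M : Mat2) (q : QF) (x : ℝ) :
    Qval (qslash M q) x =
      (q.1 : ℝ) * ((M 0 0 : ℝ) * x + M 0 1) ^ 2 +
        (q.2.1 : ℝ) * ((M 0 0 : ℝ) * x + M 0 1) * ((M 1 0 : ℝ) * x + M 1 1) +
        (q.2.2 : ℝ) * ((M 1 0 : ℝ) * x + M 1 1) ^ 2 := by
  simp only [Qval, qslash, Qhom]
  push_cast
  ring

theorem qslash_qslash (M N : Mat2) (q : QF) : qslash N (qslash M q) = qslash (M * N) q := by
  simp only [qslash, Qhom, Matrix.mul_apply, Fin.sum_univ_two, Prod.mk.injEq]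
  refine ⟨?_, ?_, ?_⟩ <;> ring

theorem qslash_one (q : QF) : qslash 1 q = q := by
  simp [qslash, Qhom]

theorem Qdisc_qslash (M : Mat2) (q : QF) : Qdisc (qslash M q) = M.det ^ 2 * Qdisc q := by
  simp only [Qdisc, qslash, Qhom, Matrix.det_fin_two]
  ring

/-- The matrix `[[p_{i-1}, p_{i-2}], [q_{i-1}, q_{i-2}]]` of consecutive convergents. -/
def convMat (x : ℝ) (i : ℕ) : Mat2 := !![pconv x (i + 1), pconv x i; qconv x (i + 1), qconv x i]

theorem gam_succ (x : ℝ) (i : ℕ) :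
    gam x (i + 1) = !![0, 1; 1, -cfN x i] * gam x i := by
  simp [gam, Meps, Tpow]

theorem convMat_succ (x : ℝ) (i : ℕ) :
    convMat x (i + 1) = convMat x i * !![cfN x i, 1; 1, 0] := by
  simp [convMat, pconv, qconv, mul_comm]

theorem convMat_mul_gam (x : ℝ) (i : ℕ) : convMat x i * gam x i = 1 := by
  induction i with
  | zero => simp [convMat, gam, pconv, qconv, Matrix.one_fin_two]
  | succ i ih =>
    have h : (!![cfN x i, 1; 1, 0] : Mat2) * !![0, 1; 1, -cfN x i] = 1 := by
      simp [Matrix.one_fin_two]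
    rw [convMat_succ, gam_succ, Matrix.mul_assoc, ← Matrix.mul_assoc _ _ (gam x i), h,
      Matrix.one_mul, ih]

theorem det_convMat_sq (x : ℝ) (i : ℕ) : (convMat x i).det ^ 2 = 1 := by
  have h := congrArg Matrix.det (convMat_mul_gam x i)
  rw [Matrix.det_mul, Matrix.det_one] at h
  rcases Int.eq_one_or_neg_one_of_mul_eq_one h with h | h <;> simp [h]

theorem det_gam_sq (x : ℝ) (i : ℕ) : (gam x i).det ^ 2 = 1 := by
  have h := congrArg Matrix.det (convMat_mul_gam x i)
  rw [Matrix.det_mul, Matrix.det_one, mul_comm] at h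
  rcases Int.eq_one_or_neg_one_of_mul_eq_one h with h | h <;> simp [h]

theorem gam_succ_apply_zero (x : ℝ) (i : ℕ) (j : Fin 2) : gam x (i + 1) 0 j = gam x i 1 j := by
  simp [gam_succ, Matrix.mul_apply]

theorem gam_succ_apply_one (x : ℝ) (i : ℕ) (j : Fin 2) :
    gam x (i + 1) 1 j = gam x i 0 j - cfN x i * gam x i 1 j := by
  simp [gam_succ, Matrix.mul_apply]
  ring

theorem gam_entries (x : ℝ) (i : ℕ) :
    gam x i 0 0 = (-1) ^ i * qconv x i ∧ gam x i 1 0 = -((-1) ^ i * qconv x (i + 1)) ∧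
      gam x i 0 1 = -((-1) ^ i * pconv x i) ∧ gam x i 1 1 = (-1) ^ i * pconv x (i + 1) := by
  induction i with
  | zero => simp [gam, pconv, qconv]
  | succ i ih =>
    obtain ⟨h1, h2, h3, h4⟩ := ih
    simp only [gam_succ_apply_zero, gam_succ_apply_one, h1, h2, h3, h4, pconv, qconv]
    refine ⟨?_, ?_, ?_, ?_⟩ <;> ring

theorem gam_one_mul_add (x : ℝ) (i : ℕ) :
    (gam x i 1 0 : ℝ) * x + gam x i 1 1 = cfDelta x i := by
  obtain ⟨-, h2, -, h4⟩ := gam_entries x i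
  rw [h2, h4, cfDelta]
  push_cast
  ring

theorem Qval_qslash_gam_succ (q : QF) (x : ℝ) (i : ℕ) :
    Qval (qslash (gam x (i + 1)) q) x =
      (q.1 : ℝ) * cfDelta x i ^ 2 + (q.2.1 : ℝ) * cfDelta x i * cfDelta x (i + 1) +
        (q.2.2 : ℝ) * cfDelta x (i + 1) ^ 2 := by
  rw [Qval_qslash, gam_one_mul_add, gam_succ_apply_zero, gam_succ_apply_zero, gam_one_mul_add]

theorem cfDelta_succ_succ (x : ℝ) (i : ℕ) :
    cfDelta x (i + 2) = cfDelta x i - cfN x (i + 1) * cfDelta x (i + 1) := by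
  simp only [cfDelta, pconv, qconv]
  push_cast
  ring

theorem irrational_cfX {x : ℝ} (hx : Irrational x) (i : ℕ) : Irrational (cfX x i) := by
  induction i with
  | zero => exact hx
  | succ i ih =>
    rw [cfX, one_div]
    exact (ih.sub_intCast _).inv

theorem one_lt_cfX_succ {x : ℝ} (hx : Irrational x) (i : ℕ) : 1 < cfX x (i + 1) := by
  have h := irrational_cfX hx i
  have h0 : 0 < cfX x i - (⌊cfX x i⌋ : ℝ) :=
    lt_of_le_of_ne (Int.fract_nonneg _) (h.sub_intCast _).ne_zero.symm
  rw [cfX, lt_div_iff₀ h0, one_mul]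
  exact Int.fract_lt_one _

theorem one_le_cfN_succ {x : ℝ} (hx : Irrational x) (i : ℕ) : 1 ≤ cfN x (i + 1) :=
  Int.le_floor.2 (by exact_mod_cast (one_lt_cfX_succ hx i).le)

theorem cfX_succ_mul_cfDelta {x : ℝ} (hx : Irrational x) (i : ℕ) :
    cfX x (i + 1) * cfDelta x (i + 1) = cfDelta x i := by
  have hne (i : ℕ) : cfX x i - (⌊cfX x i⌋ : ℝ) ≠ 0 :=
    ((irrational_cfX hx i).sub_intCast _).ne_zero
  induction i with
  | zero =>
    have h := hne 0
    have h1 : cfDelta x 1 = cfX x 0 - (⌊cfX x 0⌋ : ℝ) := by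
      simp [cfDelta, pconv, qconv, cfN, cfX]
    have h0 : cfDelta x 0 = 1 := by simp [cfDelta, pconv, qconv]
    rw [h1, h0]
    exact one_div_mul_cancel h
  | succ i ih =>
    have h := hne (i + 1)
    rw [cfDelta_succ_succ, ← ih, cfX, cfN, ← sub_mul, one_div, inv_mul_cancel_left₀ h]

theorem cfDelta_pos {x : ℝ} (hx : Irrational x) (i : ℕ) : 0 < cfDelta x i := by
  induction i with
  | zero => simp [cfDelta, pconv, qconv]
  | succ i ih =>
    rw [← cfX_succ_mul_cfDelta hx] at ih
    exact pos_of_mul_pos_right ih (zero_le_one.trans (one_lt_cfX_succ hx i).le)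

theorem cfDelta_succ_lt {x : ℝ} (hx : Irrational x) (i : ℕ) :
    cfDelta x (i + 1) < cfDelta x i := by
  rw [← cfX_succ_mul_cfDelta hx i]
  exact lt_mul_of_one_lt_left (cfDelta_pos hx _) (one_lt_cfX_succ hx i)

theorem cfDelta_le_one {x : ℝ} (hx : Irrational x) (i : ℕ) : cfDelta x i ≤ 1 := by
  induction i with
  | zero => simp [cfDelta, pconv, qconv]
  | succ i ih => exact (cfDelta_succ_lt hx i).le.trans ih

theorem cfDelta_le_geometric {x : ℝ} (hx : Irrational x) (i : ℕ) :
    cfDelta x i ≤ 2 * (3 / 4 : ℝ) ^ i := by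
  induction i using Nat.twoStepInduction with
  | zero => linarith [cfDelta_le_one hx 0]
  | one => linarith [cfDelta_le_one hx 1]
  | more i ih _ =>
    have h1 : (1 : ℝ) ≤ cfN x (i + 1) := by exact_mod_cast one_le_cfN_succ hx i
    have h2 := cfDelta_succ_succ x i
    have h3 := cfDelta_succ_lt hx (i + 1)
    have h4 := cfDelta_pos hx (i + 1)
    have h5 : (0 : ℝ) < (3 / 4) ^ i := by positivity
    rw [pow_add]
    nlinarith

theorem qconv_succ_nonneg {x : ℝ} (hx : Irrational x) (i : ℕ) :
    0 ≤ qconv x (i + 1) ∧ 1 ≤ qconv x (i + 2) := by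
  induction i with
  | zero => simp [qconv]
  | succ i ih =>
    obtain ⟨h1, h2⟩ := ih
    have hn := one_le_cfN_succ hx i
    refine ⟨by linarith, ?_⟩
    rw [qconv]
    nlinarith

theorem qconv_succ_le {x : ℝ} (hx : Irrational x) (i : ℕ) :
    qconv x (i + 1) ≤ qconv x (i + 2) := by
  cases i with
  | zero => simp [qconv]
  | succ i =>
    obtain ⟨h1, h2⟩ := qconv_succ_nonneg hx i
    have hn := one_le_cfN_succ hx i
    show qconv x (i + 2) ≤ cfN x (i + 1) * qconv x (i + 2) + qconv x (i + 1)
    nlinarith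

theorem le_qconv {x : ℝ} (hx : Irrational x) (i : ℕ) : (i : ℤ) ≤ qconv x (i + 3) := by
  induction i with
  | zero => exact zero_le_one.trans (qconv_succ_nonneg hx 1).2
  | succ i ih =>
    have h1 := (qconv_succ_nonneg hx i).2
    have hn := one_le_cfN_succ hx (i + 1)
    show _ ≤ cfN x (i + 2) * qconv x (i + 3) + qconv x (i + 2)
    push_cast
    nlinarith

theorem coeff_bounds_of_mem_SimpleD {D : ℕ} {a b c : ℤ} (h : (a, b, c) ∈ SimpleD D) :
    (-(D : ℤ) ≤ a ∧ a ≤ D) ∧ (-(D : ℤ) ≤ b ∧ b ≤ D) ∧ -(D : ℤ) ≤ c ∧ c ≤ D := by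
  obtain ⟨h, ha, hc⟩ := h
  simp only [Qdisc] at h ha hc
  refine ⟨⟨?_, ?_⟩, ⟨?_, ?_⟩, ?_, ?_⟩ <;>
    nlinarith [sq_nonneg b, sq_nonneg (b - 1), sq_nonneg (b + 1), mul_pos ha (neg_pos.2 hc)]

theorem finite_SimpleD (D : ℕ) : (SimpleD D).Finite := by
  have hI := Set.finite_Icc (-(D : ℤ)) D
  exact (hI.prod (hI.prod hI)).subset fun _ h => coeff_bounds_of_mem_SimpleD h

theorem finite_QDx_ratCast (D : ℕ) (r : ℚ) : (QDx D r).Finite := by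
  have hd : (0 : ℤ) < r.den := by exact_mod_cast r.den_pos
  have hdR : (0 : ℝ) < r.den := by exact_mod_cast r.den_pos
  set B : ℤ := D * (r.den : ℤ) ^ 2 with hB
  have hI := Set.finite_Icc (-B) B
  refine Set.Finite.of_injOn
    (f := fun q : QF => (q.1, 2 * q.1 * r.num + q.2.1 * (r.den : ℤ))) ?_ ?_ (hI.prod hI)
  · rintro ⟨a, b, c⟩ ⟨h, ha, hx⟩
    simp only [Qdisc, Qval] at h ha hx
    have hN : 0 < a * r.num ^ 2 + b * r.num * r.den + c * (r.den : ℤ) ^ 2 := by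
      have h1 : (r : ℝ) = r.num / r.den := by exact_mod_cast (Rat.num_div_den r).symm
      have h2 := mul_pos hx (pow_pos hdR 2)
      have h3 : ((a : ℝ) * (r : ℝ) ^ 2 + b * r + c) * (r.den : ℝ) ^ 2 =
          a * r.num ^ 2 + b * r.num * r.den + c * (r.den : ℝ) ^ 2 := by
        rw [h1]
        field_simp
      rw [h3] at h2
      exact_mod_cast h2
    set N := a * r.num ^ 2 + b * r.num * r.den + c * (r.den : ℤ) ^ 2 with hNdef
    set y := 2 * a * r.num + b * (r.den : ℤ) with hy
    have key : y ^ 2 + 4 * (-a) * N = B := by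
      rw [hB, ← h, hy, hNdef]
      ring
    have haN : -a ≤ -a * N := by nlinarith
    have haN' : 0 < -a * N := by nlinarith
    simp only [Set.mem_prod, Set.mem_Icc]
    refine ⟨⟨?_, ?_⟩, ?_, ?_⟩ <;> nlinarith [sq_nonneg y, sq_nonneg (y - 1), sq_nonneg (y + 1)]
  · rintro ⟨a, b, c⟩ ⟨h, ha, -⟩ ⟨a', b', c'⟩ ⟨h', -, -⟩ heq
    simp only [Qdisc, Prod.mk.injEq] at h ha h' heq ⊢
    obtain ⟨rfl, h2⟩ := heq
    obtain rfl : b = b' := mul_right_cancel₀ hd.ne' (by linarith)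
    refine ⟨rfl, rfl, ?_⟩
    have h4 : 4 * a ≠ 0 := by omega
    exact mul_left_cancel₀ h4 (by linarith)

theorem exists_Qhom_conv_pos {x : ℝ} (hx : Irrational x) (q : QF) (hq : 0 < Qval q x) :
    ∃ j, 0 < Qhom q (pconv x (j + 1)) (qconv x (j + 1)) := by
  obtain ⟨a, b, c⟩ := q
  simp only [Qval] at hq
  set v : ℝ := a * x ^ 2 + b * x + c with hv
  obtain ⟨N, hN⟩ := exists_nat_gt ((|2 * a * x + b| + |(a : ℝ)|) / v)
  rw [div_lt_iff₀ hq] at hN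
  refine ⟨N + 2, ?_⟩
  have h1 : (1 : ℝ) ≤ qconv x (N + 3) := by exact_mod_cast (qconv_succ_nonneg hx (N + 1)).2
  have h2 : (N : ℝ) ≤ qconv x (N + 3) := by exact_mod_cast le_qconv hx N
  have h3 : |(pconv x (N + 3) : ℝ) - qconv x (N + 3) * x| ≤ 1 := by
    have h := cfDelta_le_one hx (N + 2)
    rw [← abs_of_pos (cfDelta_pos hx (N + 2)), cfDelta, abs_mul, abs_pow, abs_neg, abs_one,
      one_pow, one_mul] at h
    exact h
  have h4 : ((Qhom (a, b, c) (pconv x (N + 3)) (qconv x (N + 3)) : ℤ) : ℝ) =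
      v * (qconv x (N + 3) : ℝ) ^ 2 + (2 * a * x + b) *
        (pconv x (N + 3) - qconv x (N + 3) * x) * qconv x (N + 3) +
        a * (pconv x (N + 3) - qconv x (N + 3) * x) ^ 2 := by
    simp only [Qhom, hv]
    push_cast
    ring
  rw [← Int.cast_pos (R := ℝ), h4]
  set s : ℝ := ((qconv x (N + 3) : ℤ) : ℝ)
  set e : ℝ := (pconv x (N + 3) : ℝ) - s * x
  have h5 : -|2 * a * x + b| ≤ (2 * a * x + b) * e := by
    have h := abs_mul (2 * a * x + b) e
    have h' := neg_abs_le ((2 * a * x + b) * e)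
    nlinarith [abs_nonneg (2 * a * x + b)]
  have h6 : -|(a : ℝ)| ≤ a * e ^ 2 := by
    have h := neg_abs_le (a : ℝ)
    have he : e ^ 2 ≤ 1 := (sq_le_one_iff_abs_le_one e).2 h3
    nlinarith [abs_nonneg (a : ℝ), sq_nonneg e]
  have h7 : |2 * a * x + b| + |(a : ℝ)| < s * v := hN.trans_le (by gcongr)
  nlinarith [abs_nonneg (a : ℝ)]

theorem exists_eq_qslash_gam {D : ℕ} (hns : ¬ IsSquare D) {x : ℝ} (hx : Irrational x) {q : QF}
    (hq : q ∈ QDx D x) : ∃ s ∈ SimpleD D, ∃ i, q = qslash (gam x (i + 1)) s := by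
  classical
  obtain ⟨hD, ha, hv⟩ := hq
  have hex := exists_Qhom_conv_pos hx q hv
  have hpos := Nat.find_spec hex
  rcases hf : Nat.find hex with _ | i
  · rw [hf] at hpos
    simp [Qhom, pconv, qconv] at hpos
    omega
  · rw [hf] at hpos
    have hneg := not_lt.1 (Nat.find_min hex (hf.symm ▸ Nat.lt_succ_self i : i < Nat.find hex))
    have hdisc : Qdisc (qslash (convMat x (i + 1)) q) = D := by
      rw [Qdisc_qslash, det_convMat_sq, one_mul, hD]
    refine ⟨qslash (convMat x (i + 1)) q, ⟨hdisc, hpos, ?_⟩, i, ?_⟩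
    · refine lt_of_le_of_ne hneg fun h0 => hns ?_
      have h1 : (qslash (convMat x (i + 1)) q).2.2 = 0 := h0
      rw [Qdisc, h1, mul_zero, sub_zero] at hdisc
      have h2 : IsSquare (D : ℤ) := ⟨_, by rw [← hdisc, sq]⟩
      exact_mod_cast h2
    · rw [qslash_qslash, convMat_mul_gam, qslash_one]

theorem abs_Qval_qslash_gam_le {D : ℕ} {s : QF} (hs : s ∈ SimpleD D) {x : ℝ} (hx : Irrational x)
    (i : ℕ) : |Qval (qslash (gam x (i + 1)) s) x| ≤ 6 * D * (3 / 4 : ℝ) ^ i := by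
  obtain ⟨a, b, c⟩ := s
  obtain ⟨⟨ha1, ha2⟩, ⟨hb1, hb2⟩, hc1, hc2⟩ := coeff_bounds_of_mem_SimpleD hs
  rw [Qval_qslash_gam_succ]
  have habs {z : ℤ} (h1 : -(D : ℤ) ≤ z) (h2 : z ≤ D) : |(z : ℝ)| ≤ D := by
    exact_mod_cast abs_le.2 ⟨h1, h2⟩
  set y := cfDelta x i
  set z := cfDelta x (i + 1)
  have hz : 0 < z := cfDelta_pos hx _
  have hzy : z < y := cfDelta_succ_lt hx i
  have hy : y ≤ 1 := cfDelta_le_one hx i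
  have hg : y ≤ 2 * (3 / 4 : ℝ) ^ i := cfDelta_le_geometric hx i
  have hD0 : (0 : ℝ) ≤ D := Nat.cast_nonneg D
  have hterm {w u v : ℝ} (hw : |w| ≤ D) (hu : 0 ≤ u ∧ u ≤ y) (hv : 0 ≤ v ∧ v ≤ 1) :
      |w * u * v| ≤ D * y := by
    rw [abs_mul, abs_mul, abs_of_nonneg hu.1, abs_of_nonneg hv.1]
    calc |w| * u * v ≤ |w| * u * 1 :=
          mul_le_mul_of_nonneg_left hv.2 (mul_nonneg (abs_nonneg w) hu.1)
      _ ≤ D * y := by rw [mul_one]; exact mul_le_mul hw hu.2 hu.1 hD0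
  have h1 := hterm (habs ha1 ha2) (u := y) (v := y) ⟨by linarith, le_rfl⟩ ⟨by linarith, hy⟩
  have h2 := hterm (habs hb1 hb2) (u := y) (v := z) ⟨by linarith, le_rfl⟩ ⟨hz.le, by linarith⟩
  have h3 := hterm (habs hc1 hc2) (u := z) (v := z) ⟨hz.le, hzy.le⟩ ⟨hz.le, by linarith⟩
  have h4 : (D : ℝ) * y ≤ D * (2 * (3 / 4 : ℝ) ^ i) := by gcongr
  rw [sq, sq, ← mul_assoc, ← mul_assoc]
  calc _ ≤ _ := abs_add_three _ _ _
    _ ≤ D * y + D * y + D * y := by gcongr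
    _ ≤ _ := by linarith

theorem summable_Qval_pow {D : ℕ} (hns : ¬ IsSquare D) {x : ℝ} (hx : Irrational x) {n : ℕ}
    (hn : n ≠ 0) : Summable (fun q : QDx D x => Qval q.1 x ^ n) := by
  choose s hs i hi using fun q : QDx D x => exists_eq_qslash_gam hns hx q.2
  have : Finite (SimpleD D) := (finite_SimpleD D).to_subtype
  let F : SimpleD D × ℕ → ℝ := fun p => Qval (qslash (gam x (p.2 + 1)) p.1.1) x ^ n
  have hF : Summable F := by
    have h1 : Summable fun _ : SimpleD D => ((6 * D : ℝ)) ^ n := Summable.of_finite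
    have h2 : Summable fun i : ℕ => (((3 / 4 : ℝ)) ^ n) ^ i :=
      summable_geometric_of_lt_one (by positivity) (pow_lt_one₀ (by norm_num) (by norm_num) hn)
    refine Summable.of_norm_bounded
      (h1.mul_of_nonneg h2 (fun _ => by positivity) fun _ => by positivity) fun p => ?_
    rw [Real.norm_eq_abs, abs_pow, pow_right_comm, ← mul_pow]
    exact pow_le_pow_left₀ (abs_nonneg _) (abs_Qval_qslash_gam_le p.1.2 hx p.2) n
  have hinj : Function.Injective fun q : QDx D x => ((⟨s q, hs q⟩, i q) : SimpleD D × ℕ) := by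
    intro q q' h
    simp only [Prod.mk.injEq, Subtype.mk.injEq] at h
    exact Subtype.ext (by rw [hi q, hi q', h.1, h.2])
  refine (hF.comp_injective hinj).congr fun q => ?_
  simp only [Function.comp_apply, F]
  rw [← hi q]

theorem exists_form_neg_neg_pos {D : ℕ} (hD : 0 < D) (hns : ¬ IsSquare D)
    (hmod : D % 4 = 0 ∨ D % 4 = 1) :
    ∃ b c : ℤ, Qdisc (1, b, c) = D ∧ c < 0 ∧ 1 - b + c < 0 ∧ 0 < 1 + b + c := by
  have hns' (m : ℕ) : D ≠ m * m := fun h => hns ⟨m, h⟩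
  have h1 : D ≠ 1 := hns' 1
  have h4 : D ≠ 4 := hns' 2
  have hs1 : Nat.sqrt D * Nat.sqrt D < D := lt_of_le_of_ne (Nat.sqrt_le D) (hns' _).symm
  have hs3 := Nat.lt_succ_sqrt D
  set s := Nat.sqrt D
  have hs4 : 2 ≤ s := by
    by_contra! h
    have : s ≤ 1 := by omega
    have : s.succ * s.succ ≤ 2 * 2 := Nat.mul_le_mul (by omega) (by omega)
    omega
  obtain ⟨b, hb, hbs, hbs'⟩ : ∃ b : ℤ, b % 2 = D % 2 ∧ b ≤ s ∧ (s : ℤ) ≤ b + 1 :=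
    ⟨s - ((s + D) % 2 : ℤ), by omega, by omega, by omega⟩
  obtain ⟨c, hc⟩ : (4 : ℤ) ∣ b ^ 2 - D := by
    rcases Int.even_or_odd' b with ⟨t, rfl | rfl⟩
    · have : (2 * t) ^ 2 = 4 * (t * t) := by ring
      omega
    · have : (2 * t + 1) ^ 2 = 4 * (t * t + t) + 1 := by ring
      omega
  have hsD : (s : ℤ) * s < D := by exact_mod_cast hs1
  have hsD' : (D : ℤ) < (s + 1) * (s + 1) := by exact_mod_cast hs3
  have hs5 : (2 : ℤ) ≤ s := by exact_mod_cast hs4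
  refine ⟨b, c, ?_, ?_, ?_, ?_⟩
  · simp only [Qdisc]
    linarith
  · nlinarith
  · nlinarith
  · nlinarith

theorem infinite_QDx {D : ℕ} (hD : 0 < D) (hns : ¬ IsSquare D)
    (hmod : D % 4 = 0 ∨ D % 4 = 1) {x : ℝ} (hx : Irrational x) : (QDx D x).Infinite := by
  obtain ⟨b, c, hdisc, hc, hn, hp⟩ := exists_form_neg_neg_pos hD hns hmod
  set f : QF := (1, b, c) with hf
  have hmem (i : ℕ) : qslash (gam x (i + 1)) f ∈ QDx D x := by
    refine ⟨by rw [Qdisc_qslash, det_gam_sq, one_mul, hdisc], ?_, ?_⟩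
    · obtain ⟨h1, h2, -, -⟩ := gam_entries x (i + 1)
      have hq := (qconv_succ_nonneg hx i)
      have hle := qconv_succ_le hx i
      show Qhom f (gam x (i + 1) 0 0) (gam x (i + 1) 1 0) < 0
      rw [h1, h2]
      have hsq : ((-1 : ℤ) ^ (i + 1)) ^ 2 = 1 := by rw [← pow_mul, mul_comm, pow_mul]; simp
      set p := qconv x (i + 1)
      set q := qconv x (i + 1 + 1)
      have : Qhom f ((-1) ^ (i + 1) * p) (-((-1) ^ (i + 1) * q)) =
          p ^ 2 - b * p * q + c * q ^ 2 := by
        simp only [Qhom, hf]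
        linear_combination (p ^ 2 - b * p * q + c * q ^ 2) * hsq
      rw [this]
      have hp0 : 0 ≤ p := hq.1
      have hq0 : 1 ≤ q := hq.2
      have hpq : p ≤ q := hle
      have h3 : (1 - b + c) * (p * q) ≤ (1 - b + c) * p ∧ (1 - b + c) * p ≤ 0 := by
        constructor
        · nlinarith [mul_nonneg hp0 (sub_nonneg.2 hq0)]
        · nlinarith
      have h4 : c * (q * (q - p)) ≤ c * (q - p) := by
        nlinarith [mul_nonneg (sub_nonneg.2 hpq) (sub_nonneg.2 hq0)]
      have h5 : p * p ≤ p * q := by gcongr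
      have h6 : (1 - b + c) * p + c * (q - p) < 0 := by
        rcases hp0.eq_or_lt with h0 | h0 <;> nlinarith
      nlinarith
    · rw [Qval_qslash_gam_succ]
      have hz := cfDelta_pos hx (i + 1)
      have hzy := cfDelta_succ_lt hx i
      set y := cfDelta x i
      set z := cfDelta x (i + 1)
      have hcR : (c : ℝ) < 0 := by exact_mod_cast hc
      have hpR : (0 : ℝ) < 1 + b + c := by exact_mod_cast hp
      have h1 := mul_pos hpR (mul_pos (hz.trans hzy) hz)
      have h2 := mul_pos (hz.trans hzy) (sub_pos.2 hzy)
      have h3 := mul_pos (neg_pos.2 hcR) (mul_pos hz (sub_pos.2 hzy))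
      simp only [hf, Int.cast_one]
      nlinarith
  intro hfin
  have hlim : Filter.Tendsto (fun i => Qval (qslash (gam x (i + 1)) f) x)
      Filter.atTop (nhds 0) := by
    have h1 := (tendsto_pow_atTop_nhds_zero_of_lt_one (r := (3 / 4 : ℝ)) (by norm_num)
      (by norm_num)).const_mul (6 * (D : ℝ))
    rw [mul_zero] at h1
    exact squeeze_zero_norm
      (fun i => abs_Qval_qslash_gam_le (s := f) ⟨hdisc, zero_lt_one, hc⟩ hx i) h1
  obtain ⟨q, hq, hq0⟩ := (hfin.image fun q => Qval q x).isClosed.mem_of_tendsto hlim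
    (Filter.Eventually.of_forall fun i => Set.mem_image_of_mem _ (hmem i))
  exact hq.2.2.ne' hq0

/-- **Corollary: exponential convergence.** For `k ≥ 2` and a positive
non-square discriminant `D`: the family `(Q(x)^{k-1})_{Q ∈ 𝒬_D⟨x⟩}` is summable for every
real `x`; the index set `𝒬_D⟨x⟩` is finite iff `x` is rational; and for irrational `x`
the quantities `δ_i` decay exponentially and
`(Q|γ_i)(x) = a δ_{i-1}² + b δ_{i-1}δ_i + c δ_i²` for all `Q = [a,b,c]` of
discriminant `D` and all `i ≥ 1`. -/
theorem stmt10 (k : ℕ) (hk : 2 ≤ k) (D : ℕ) (hD : 0 < D) (hns : ¬ IsSquare D)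
    (hmod : D % 4 = 0 ∨ D % 4 = 1) :
    (∀ x : ℝ, Summable (fun q : ↥(QDx D x) => Qval q.1 x ^ (k - 1))) ∧
    (∀ x : ℝ, (QDx D x).Finite ↔ ¬ Irrational x) ∧
    (∀ x : ℝ, Irrational x →
      (∃ C : ℝ, 0 < C ∧ ∃ θ : ℝ, 0 < θ ∧ θ < 1 ∧
        ∀ i : ℕ, cfDelta x i ≤ C * θ ^ i) ∧
      (∀ q : QF, Qdisc q = (D : ℤ) → ∀ i : ℕ, 1 ≤ i →
        Qval (qslash (gam x i) q) x =
          (q.1 : ℝ) * cfDelta x (i - 1) ^ 2 +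
            (q.2.1 : ℝ) * cfDelta x (i - 1) * cfDelta x i +
            (q.2.2 : ℝ) * cfDelta x i ^ 2)) := by
  have hrat {x : ℝ} (hx : ¬ Irrational x) : (QDx D x).Finite := by
    obtain ⟨r, rfl⟩ := not_not.1 hx
    exact finite_QDx_ratCast D r
  refine ⟨fun x => ?_, fun x => ⟨fun h hx => infinite_QDx hD hns hmod hx h, hrat⟩,
    fun x hx => ⟨⟨2, two_pos, 3 / 4, by norm_num, by norm_num, cfDelta_le_geometric hx⟩, ?_⟩⟩
  · by_cases hx : Irrational x
    · exact summable_Qval_pow hns hx (by omega)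
    · have := (hrat hx).to_subtype
      exact Summable.of_finite
  · rintro q - (_ | i) hi
    · omega
    · exact Qval_qslash_gam_succ q x i
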